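/- arXiv:1910.00642 — 2 statements merged into one kernel-verified Lean document; each statement's English description precedes it below -/
import Mathlib

section
/- Let G be a 2-connected graph, A ⊆ V(G), z ∈ A a vertex of degree at least 4k in G, and suppose every even A-cycle of G contains z. Then G contains k edge-disjoint even A-cycles. -/
/-- `G` is 2-connected. -/
def TwoConnected {V : Type*} [Fintype V] (G : SimpleGraph V) : Prop :=
  3 ≤ Fintype.card V ∧ ∀ v : V, (G.induce {x : V | x ≠ v}).Connected

namespace SimpleGraph

/-- Splitting a walk at one of its edges. -/
lemma Walk.exists_split_of_mem_edges {U : Type*} {T : SimpleGraph U} {a b x y : U}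
    (w : T.Walk a b) (h : s(x, y) ∈ w.edges) :
    (∃ (p : T.Walk a x) (q : T.Walk y b), p.length + 1 + q.length = w.length) ∨
      ∃ (p : T.Walk a y) (q : T.Walk x b), p.length + 1 + q.length = w.length := by
  induction w with
  | nil => simp at h
  | @cons u v b huv p ih =>
    rw [Walk.edges_cons, List.mem_cons] at h
    rcases h with h | h
    · rcases Sym2.eq_iff.1 h with ⟨rfl, rfl⟩ | ⟨rfl, rfl⟩
      · exact .inl ⟨.nil, p, by simp [add_comm]⟩
      · exact .inr ⟨.nil, p, by simp [add_comm]⟩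
    · rcases ih h with ⟨q, r, hqr⟩ | ⟨q, r, hqr⟩
      · exact .inl ⟨.cons huv q, r, by simp only [Walk.length_cons]; lia⟩
      · exact .inr ⟨.cons huv q, r, by simp only [Walk.length_cons]; lia⟩

/-- If two geodesics `a`–`b` and `c`–`d` share an edge, then the four ends can be re-paired with a
smaller sum of distances. -/
lemma dist_add_dist_lt_of_common_edge {U : Type*} {T : SimpleGraph U} {a b c d : U}
    (p : T.Walk a b) (q : T.Walk c d) (hp : p.length = T.dist a b) (hq : q.length = T.dist c d)
    {e : Sym2 U} (hep : e ∈ p.edges) (heq : e ∈ q.edges) :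
    T.dist a c + T.dist b d < T.dist a b + T.dist c d ∨
      T.dist a d + T.dist c b < T.dist a b + T.dist c d := by
  induction e with | _ x y
  rcases p.exists_split_of_mem_edges hep with ⟨p₁, p₂, h⟩ | ⟨p₁, p₂, h⟩ <;>
  rcases q.exists_split_of_mem_edges heq with ⟨q₁, q₂, h'⟩ | ⟨q₁, q₂, h'⟩
  · left
    have h₁ := dist_le (p₁.append q₁.reverse)
    have h₂ := dist_le (p₂.reverse.append q₂)
    simp only [Walk.length_append, Walk.length_reverse] at h₁ h₂
    lia
  · right
    have h₁ := dist_le (p₁.append q₂)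
    have h₂ := dist_le (q₁.append p₂)
    simp only [Walk.length_append] at h₁ h₂
    lia
  · right
    have h₁ := dist_le (p₁.append q₂)
    have h₂ := dist_le (q₁.append p₂)
    simp only [Walk.length_append] at h₁ h₂
    lia
  · left
    have h₁ := dist_le (p₁.append q₁.reverse)
    have h₂ := dist_le (p₂.reverse.append q₂)
    simp only [Walk.length_append, Walk.length_reverse] at h₁ h₂
    lia

/-- In a connected graph, any `2n` vertices contain the ends of `n` edge-disjoint paths with
distinct ends. -/
lemma Connected.exists_edge_disjoint_paths {U ι : Type*} [Fintype ι] {T : SimpleGraph U}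
    (hT : T.Connected) (S : Finset U) (hS : 2 * Fintype.card ι ≤ S.card) :
    ∃ (f : ι × Bool ↪ S) (w : ∀ i, T.Walk (f (i, false) : U) (f (i, true))),
      (∀ i, (w i).IsPath) ∧ ∀ i j, i ≠ j → ∀ e ∈ (w i).edges, e ∉ (w j).edges := by
  classical
  have : Nonempty (ι × Bool ↪ S) := by
    apply Function.Embedding.nonempty_of_card_le
    simpa [mul_comm] using hS
  let cost : (ι × Bool ↪ S) → ℕ := fun f ↦ ∑ i, T.dist (f (i, false) : U) (f (i, true))
  let f := Function.argmin cost
  have hmin : ∀ g, cost f ≤ cost g := fun g ↦ Function.argmin_le cost g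
  choose w hw using fun i ↦ hT.exists_walk_length_eq_dist (f (i, false) : U) (f (i, true))
  refine ⟨f, w, fun i ↦ (w i).isPath_of_length_eq_dist (hw i), fun i j hij e hei hej ↦ ?_⟩
  have hsplit : ∀ g : ι × Bool ↪ S, cost g =
      T.dist (g (i, false) : U) (g (i, true)) + (T.dist (g (j, false) : U) (g (j, true)) +
        ∑ l ∈ (Finset.univ.erase i).erase j, T.dist (g (l, false) : U) (g (l, true))) := by
    intro g
    rw [Finset.add_sum_erase _ (fun l ↦ T.dist (g (l, false) : U) (g (l, true)))
        (by simpa using hij.symm),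
      Finset.add_sum_erase _ (fun l ↦ T.dist (g (l, false) : U) (g (l, true)))
        (Finset.mem_univ i)]
  have hswap : ∀ b : Bool,
      ∑ l ∈ (Finset.univ.erase i).erase j,
        T.dist (((Equiv.swap (i, true) (j, b)).toEmbedding.trans f) (l, false) : U)
          (((Equiv.swap (i, true) (j, b)).toEmbedding.trans f) (l, true)) =
      ∑ l ∈ (Finset.univ.erase i).erase j, T.dist (f (l, false) : U) (f (l, true)) := by
    intro b
    refine Finset.sum_congr rfl fun l hl ↦ ?_
    obtain ⟨hlj, hli, -⟩ : l ≠ j ∧ l ≠ i ∧ True := by simpa using hl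
    simp [Equiv.swap_apply_of_ne_of_ne, hlj, hli]
  have hlt := dist_add_dist_lt_of_common_edge (w i) (w j) (hw i) (hw j) hei hej
  rcases hlt with hlt | hlt
  · have h := hmin ((Equiv.swap (i, true) (j, false)).toEmbedding.trans f)
    rw [hsplit f, hsplit, hswap] at h
    simp [Equiv.swap_apply_of_ne_of_ne, hij, hij.symm] at h
    lia
  · have h := hmin ((Equiv.swap (i, true) (j, true)).toEmbedding.trans f)
    rw [hsplit f, hsplit, hswap] at h
    simp [Equiv.swap_apply_of_ne_of_ne, hij, hij.symm] at h
    lia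

/-- A path avoiding `z` between distinct neighbours of `z` closes up to a cycle through `z`. -/
lemma Walk.IsPath.isCycle_cons_concat {V : Type*} {G : SimpleGraph V} {a b z : V}
    {p : G.Walk a b} (hp : p.IsPath) (hz : z ∉ p.support) (hab : a ≠ b) (ha : G.Adj z a)
    (hb : G.Adj b z) : (Walk.cons ha (p.concat hb)).IsCycle := by
  rw [Walk.cons_isCycle_iff, Walk.concat_isPath_iff, Walk.edges_concat]
  refine ⟨⟨hp, hz⟩, fun h ↦ ?_⟩
  simp only [List.concat_eq_append, List.mem_append, List.mem_singleton] at h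
  rcases h with h | h
  · exact hz (p.fst_mem_support_of_mem_edges h)
  · rcases Sym2.eq_iff.1 h with ⟨-, rfl⟩ | ⟨-, h⟩
    · exact ha.ne rfl
    · exact hab h

end SimpleGraph

/-- If `G` is 2-connected, `z ∈ A` has degree at least `4k`, and every even `A`-cycle of `G`
contains `z`, then `G` contains `k` edge-disjoint even `A`-cycles. -/
theorem edge_disjoint_even_A_cycles_of_high_degree {V : Type*} [Fintype V] [DecidableEq V]
    (G : SimpleGraph V) [DecidableRel G.Adj] (hG : TwoConnected G)
    (A : Set V) (z : V) (hzA : z ∈ A) (k : ℕ) (hdeg : 4 * k ≤ G.degree z)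
    (hall : ∀ (v : V) (c : G.Walk v v), c.IsCycle → Even c.length →
      (∃ a ∈ A, a ∈ c.support) → z ∈ c.support) :
    ∃ (vs : Fin k → V) (cs : ∀ i, G.Walk (vs i) (vs i)),
      (∀ i, (cs i).IsCycle ∧ Even (cs i).length ∧ ∃ a ∈ A, a ∈ (cs i).support) ∧
      ∀ i j, i ≠ j → ∀ e ∈ (cs i).edges, e ∉ (cs j).edges := by
  classical
  obtain ⟨T, hTG, hT⟩ := (hG.2 z).exists_isTree_le
  let col : T.Coloring Bool := hT.colorable_two.toColoring (by simp)
  let N : Finset {x : V | x ≠ z} := Finset.univ.filter fun x ↦ G.Adj z x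
  have hN : G.degree z ≤ N.card := by
    rw [← SimpleGraph.card_neighborFinset_eq_degree,
      ← Finset.card_image_of_injective N Subtype.val_injective]
    refine Finset.card_le_card fun x hx ↦ ?_
    have hx : G.Adj z x := by simpa using hx
    exact Finset.mem_image.2 ⟨⟨x, hx.ne'⟩, by simp [N, hx], rfl⟩
  obtain ⟨b, -, hb⟩ : ∃ b ∈ (Finset.univ : Finset Bool), 2 * k ≤ (N.filter (col · = b)).card :=
    Finset.exists_le_card_fiber_of_mul_le_card_of_maps_to (fun _ _ ↦ Finset.mem_univ _)
      Finset.univ_nonempty (by simp; lia)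
  obtain ⟨f, w, hw, hdisj⟩ :=
    hT.connected.exists_edge_disjoint_paths (ι := Fin k) (N.filter (col · = b)) (by simpa using hb)
  have hf : ∀ p, G.Adj z (f p).1 ∧ col (f p) = b := fun p ↦ by
    simpa [N] using (Finset.mem_filter.1 (f p).2)
  let φ : T →g G := (SimpleGraph.Embedding.induce {x : V | x ≠ z}).toHom.comp (.ofLE hTG)
  have hadj : ∀ p, G.Adj z (φ (f p)) := fun p ↦ (hf p).1
  have hφi : Function.Injective φ := Subtype.val_injective
  have hz : ∀ i, z ∉ ((w i).map φ).support := by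
    intro i hi
    rw [SimpleGraph.Walk.support_map, List.mem_map] at hi
    obtain ⟨x, -, hx⟩ := hi
    exact x.2 hx
  have hinj : ∀ p q, φ (f p) = φ (f q) → p = q := fun p q h ↦
    f.injective (Subtype.ext (hφi h))
  let C : ∀ i, G.Walk z z := fun i ↦
    .cons (hadj (i, false)) (((w i).map φ).concat (hadj (i, true)).symm)
  refine ⟨fun _ ↦ z, C,
    fun i ↦ ⟨?_, ?_, z, hzA, (C i).start_mem_support⟩, fun i j hij e hi hj ↦ ?_⟩
  · exact ((hw i).map hφi).isCycle_cons_concat (hz i) (fun h ↦ by simpa using hinj _ _ h) _ _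
  · have : Even (w i).length := by
      rw [col.even_length_iff_congr, (hf _).2, (hf _).2]
    change Even (C i).length
    rw [SimpleGraph.Walk.length_cons, SimpleGraph.Walk.length_concat, SimpleGraph.Walk.length_map]
    exact this.add even_two
  · have key : ∀ i, e ∈ (C i).edges →
        (∃ b, e = s(z, φ (f (i, b)))) ∨ e ∈ ((w i).map φ).edges := by
      intro i h
      simp only [C, SimpleGraph.Walk.edges_cons, SimpleGraph.Walk.edges_concat,
        List.concat_eq_append, List.mem_cons, List.mem_append, List.not_mem_nil, or_false] at h
      rcases h with h | h | h
      · exact .inl ⟨false, h⟩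
      · exact .inr h
      · exact .inl ⟨true, h.trans Sym2.eq_swap⟩
    rcases key i hi with ⟨c, rfl⟩ | hi <;> rcases key j hj with ⟨d, hd⟩ | hj
    · exact hij (congrArg Prod.fst (hinj _ _ (Sym2.congr_right.1 hd)))
    · exact hz j (SimpleGraph.Walk.fst_mem_support_of_mem_edges _ hj)
    · exact hz i (SimpleGraph.Walk.fst_mem_support_of_mem_edges _ (hd ▸ hi))
    · rw [SimpleGraph.Walk.edges_map, List.mem_map] at hi hj
      obtain ⟨e₁, h₁, rfl⟩ := hi
      obtain ⟨e₂, h₂, h⟩ := hj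
      obtain rfl := Sym2.map.injective hφi h
      exact hdisj i j hij _ h₁ h₂
end

section
/- Let m > 2 be an integer. The class of A-cycles of length divisible by m does not have the edge-Erdős–Pósa property: for every h there is a graph G_h with a vertex set A such that G_h contains no two edge-disjoint A-cycles of length ≡ 0 (mod m), yet no set of at most h edges meets all A-cycles of length ≡ 0 (mod m). -/
/-- A finite loopless multigraph with edge set `edges`, in which every edge `e` carries a length
`len e` that is at least two. -/
structure LengthMultigraph (B E : Type) where
  src : E → B
  tgt : E → B
  len : E → ℕ
  edges : Finset E
  two_le_len : ∀ e, 2 ≤ len e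
  src_ne_tgt : ∀ e, src e ≠ tgt e

namespace LengthMultigraph

open SimpleGraph

variable {B E : Type} (N : LengthMultigraph B E)

open scoped Classical in
/-- The `k`-th vertex of the path of length `len e` that replaces the edge `e`. -/
noncomputable def pos (e : E) (k : ℕ) : B ⊕ E × ℕ :=
  if k = 0 then .inl (N.src e) else if k = N.len e then .inl (N.tgt e) else .inr (e, k)

/-- The `k`-th edge of the path of length `len e` that replaces the edge `e`. -/
noncomputable def seg (e : E) (k : ℕ) : Sym2 (B ⊕ E × ℕ) := s(N.pos e k, N.pos e (k + 1))

/-- The graph obtained by replacing every edge `e` by a path of length `len e`. -/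
def subdivided : SimpleGraph (B ⊕ E × ℕ) :=
  SimpleGraph.fromEdgeSet {f | ∃ e ∈ N.edges, ∃ k < N.len e, N.seg e k = f}

@[simp] lemma pos_zero (e : E) : N.pos e 0 = .inl (N.src e) := by simp [pos]

@[simp] lemma pos_len (e : E) : N.pos e (N.len e) = .inl (N.tgt e) := by
  have := N.two_le_len e
  simp [pos]; omega

lemma pos_inner {e : E} {k : ℕ} (h0 : 0 < k) (hk : k < N.len e) : N.pos e k = .inr (e, k) := by
  simp [pos, h0.ne', hk.ne]

lemma pos_ne_pos_succ (e : E) (k : ℕ) : N.pos e k ≠ N.pos e (k + 1) := by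
  have := N.two_le_len e
  simp only [pos]
  grind

lemma seg_injective {e e' : E} {k k' : ℕ} (hk : k < N.len e) (hk' : k' < N.len e')
    (h : N.seg e k = N.seg e' k') : e = e' ∧ k = k' := by
  have h1 := N.two_le_len e
  have h2 := N.two_le_len e'
  have h3 := N.src_ne_tgt e
  simp only [seg, pos, Sym2.eq_iff] at h
  grind

lemma subdivided_adj {e : E} (he : e ∈ N.edges) {k : ℕ} (hk : k < N.len e) :
    N.subdivided.Adj (N.pos e k) (N.pos e (k + 1)) := by
  rw [subdivided, SimpleGraph.fromEdgeSet_adj]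
  exact ⟨⟨e, he, k, hk, rfl⟩, N.pos_ne_pos_succ e k⟩

lemma exists_seg_of_adj {a b : B ⊕ E × ℕ} (h : N.subdivided.Adj a b) :
    ∃ e ∈ N.edges, ∃ k < N.len e, N.seg e k = s(a, b) := by
  rw [subdivided, SimpleGraph.fromEdgeSet_adj] at h
  exact h.1

variable {N}

lemma exists_seg_of_mem_edges {a b : B ⊕ E × ℕ} {c : N.subdivided.Walk a b}
    {f : Sym2 (B ⊕ E × ℕ)} (hf : f ∈ c.edges) :
    ∃ e ∈ N.edges, ∃ k < N.len e, N.seg e k = f := by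
  induction f with
  | _ x y => exact N.exists_seg_of_adj (c.adj_of_mem_edges hf)

lemma seg_mem_edges_iff_succ {a : B ⊕ E × ℕ} {c : N.subdivided.Walk a a} (hc : c.IsCycle)
    {e : E} {k : ℕ} (hk : k + 1 < N.len e) :
    N.seg e k ∈ c.edges ↔ N.seg e (k + 1) ∈ c.edges := by
  have hsub : c.toSubgraph.neighborSet (N.pos e (k + 1)) ⊆ {N.pos e k, N.pos e (k + 2)} := by
    intro w hw
    rw [Subgraph.mem_neighborSet, Walk.adj_toSubgraph_iff_mem_edges] at hw
    obtain ⟨e', -, k', hk', h⟩ := exists_seg_of_mem_edges hw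
    rw [N.pos_inner (by omega) hk] at h
    simp only [seg, Sym2.eq_iff] at h
    have : e' = e ∧ (k' = k ∨ k' = k + 1) := by
      have := N.two_le_len e'
      simp only [pos] at h
      grind
    obtain ⟨rfl, rfl | rfl⟩ := this
    · rcases h with h | h
      · exact absurd (h.1.trans (N.pos_inner (by omega) hk).symm) (N.pos_ne_pos_succ _ _)
      · exact Or.inl h.1.symm
    · rcases h with h | h
      · exact Or.inr h.2.symm
      · exact absurd (h.2.trans (N.pos_inner (by omega) hk).symm) (N.pos_ne_pos_succ _ _).symm
  have key : N.pos e (k + 1) ∈ c.support → N.seg e k ∈ c.edges ∧ N.seg e (k + 1) ∈ c.edges := by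
    intro hmem
    have h2 := hc.ncard_neighborSet_toSubgraph_eq_two hmem
    have heq := Set.eq_of_subset_of_ncard_le hsub (by rw [h2]; exact (Set.ncard_insert_le _ _).trans (by simp))
      (Set.toFinite _)
    constructor
    · have : N.pos e k ∈ c.toSubgraph.neighborSet (N.pos e (k + 1)) := by rw [heq]; simp
      rw [Subgraph.mem_neighborSet, Walk.adj_toSubgraph_iff_mem_edges] at this
      rw [seg, Sym2.eq_swap]; exact this
    · have : N.pos e (k + 2) ∈ c.toSubgraph.neighborSet (N.pos e (k + 1)) := by rw [heq]; simp
      rwa [Subgraph.mem_neighborSet, Walk.adj_toSubgraph_iff_mem_edges] at this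
  exact ⟨fun h => (key (c.snd_mem_support_of_mem_edges h)).2,
    fun h => (key (c.fst_mem_support_of_mem_edges h)).1⟩

lemma seg_mem_edges_iff {a : B ⊕ E × ℕ} {c : N.subdivided.Walk a a} (hc : c.IsCycle)
    {e : E} {k : ℕ} (hk : k < N.len e) : N.seg e k ∈ c.edges ↔ N.seg e 0 ∈ c.edges := by
  induction k with
  | zero => rfl
  | succ k ih => rw [← ih (by omega), seg_mem_edges_iff_succ hc hk]

open scoped Classical in
/-- The edges of the multigraph whose subdivisions are traversed by the walk `c`. -/
noncomputable def trace {a : B ⊕ E × ℕ} (c : N.subdivided.Walk a a) : Finset E :=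
  N.edges.filter fun e => N.seg e 0 ∈ c.edges

lemma mem_trace {a : B ⊕ E × ℕ} {c : N.subdivided.Walk a a} {e : E} :
    e ∈ trace c ↔ e ∈ N.edges ∧ N.seg e 0 ∈ c.edges := by
  classical simp [trace]

lemma exists_seg_of_mem_cycle {a : B ⊕ E × ℕ} {c : N.subdivided.Walk a a} (hc : c.IsCycle)
    {f : Sym2 (B ⊕ E × ℕ)} (hf : f ∈ c.edges) :
    ∃ e ∈ trace c, ∃ k < N.len e, N.seg e k = f := by
  obtain ⟨e, he, k, hk, rfl⟩ := exists_seg_of_mem_edges hf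
  exact ⟨e, mem_trace.2 ⟨he, (seg_mem_edges_iff hc hk).1 hf⟩, k, hk, rfl⟩

lemma seg_mem_edges {a : B ⊕ E × ℕ} {c : N.subdivided.Walk a a} (hc : c.IsCycle)
    {e : E} (he : e ∈ trace c) {k : ℕ} (hk : k < N.len e) : N.seg e k ∈ c.edges :=
  (seg_mem_edges_iff hc hk).2 (mem_trace.1 he).2

lemma length_eq_sum_trace {a : B ⊕ E × ℕ} {c : N.subdivided.Walk a a} (hc : c.IsCycle) :
    c.length = ∑ e ∈ trace c, N.len e := by
  classical
  have h1 : c.edges.toFinset =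
      ((trace c).sigma fun e => Finset.range (N.len e)).image fun p => N.seg p.1 p.2 := by
    ext f
    simp only [List.mem_toFinset, Finset.mem_image, Finset.mem_sigma, Finset.mem_range,
      Sigma.exists]
    constructor
    · intro hf
      obtain ⟨e, he, k, hk, rfl⟩ := exists_seg_of_mem_cycle hc hf
      exact ⟨e, k, ⟨he, hk⟩, rfl⟩
    · rintro ⟨e, k, ⟨he, hk⟩, rfl⟩
      exact seg_mem_edges hc he hk
  rw [← Walk.length_edges, ← List.toFinset_card_of_nodup hc.isTrail.edges_nodup, h1,
    Finset.card_image_of_injOn, Finset.card_sigma]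
  · simp
  · rintro ⟨e, k⟩ h ⟨e', k'⟩ h' heq
    simp only [Finset.coe_sigma, Set.mem_sigma_iff, Finset.mem_coe, Finset.mem_range] at h h'
    obtain ⟨rfl, rfl⟩ := N.seg_injective h.2 h'.2 heq
    rfl

open scoped Classical in
/-- The edges in `S` that are incident with the vertex `b`. -/
noncomputable def incident (N : LengthMultigraph B E) (S : Finset E) (b : B) : Finset E :=
  S.filter fun e => N.src e = b ∨ N.tgt e = b

lemma card_incident_trace {a : B ⊕ E × ℕ} {c : N.subdivided.Walk a a} (hc : c.IsCycle) (b : B) :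
    (N.incident (trace c) b).card = 0 ∨ (N.incident (trace c) b).card = 2 := by
  classical
  let nb : E → B ⊕ E × ℕ := fun e =>
    if N.src e = b then .inr (e, 1) else .inr (e, N.len e - 1)
  have hinj : Function.Injective nb := by
    intro e e' h
    simp only [nb] at h
    grind
  have hset : c.toSubgraph.neighborSet (.inl b) = ((N.incident (trace c) b).image nb : Finset _) := by
    ext w
    simp only [Subgraph.mem_neighborSet, Walk.adj_toSubgraph_iff_mem_edges, Finset.coe_image,
      Set.mem_image, Finset.mem_coe, incident, Finset.mem_filter]
    constructor
    · intro h
      obtain ⟨e, he, k, hk, heq⟩ := exists_seg_of_mem_cycle hc h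
      refine ⟨e, ?_⟩
      have h1 := N.two_le_len e
      have h2 := N.src_ne_tgt e
      simp only [seg, pos, Sym2.eq_iff] at heq
      simp only [nb]
      grind
    · rintro ⟨e, ⟨he, hb⟩, rfl⟩
      have h1 := N.two_le_len e
      simp only [nb]
      split_ifs with hs
      · have := seg_mem_edges hc he (k := 0) (by omega)
        rwa [seg, pos_zero, hs, N.pos_inner (by omega) (by omega)] at this
      · have ht := hb.resolve_left hs
        have := seg_mem_edges hc he (k := N.len e - 1) (by omega)
        rwa [seg, Nat.sub_add_cancel (by omega), pos_len, ht,
          N.pos_inner (by omega) (by omega), Sym2.eq_swap] at this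
  have hcard : (c.toSubgraph.neighborSet (.inl b)).ncard = (N.incident (trace c) b).card := by
    rw [hset, Set.ncard_coe_finset, Finset.card_image_of_injective _ hinj]
  rw [← hcard]
  by_cases hb : (.inl b : B ⊕ E × ℕ) ∈ c.support
  · exact Or.inr (hc.ncard_neighborSet_toSubgraph_eq_two hb)
  · left
    have : c.toSubgraph.neighborSet (.inl b) = ∅ := by
      ext w
      simp only [Subgraph.mem_neighborSet, Walk.adj_toSubgraph_iff_mem_edges,
        Set.mem_empty_iff_false, iff_false]
      exact fun h => hb (c.fst_mem_support_of_mem_edges h)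
    simp [this]

lemma mem_iff_of_edges_not_crossing {V : Type} {G : SimpleGraph V} {X : Set V} {a b : V}
    (c : G.Walk a b) (h : ∀ x y, s(x, y) ∈ c.edges → (x ∈ X ↔ y ∈ X)) :
    ∀ w ∈ c.support, w ∈ X ↔ a ∈ X := by
  induction c with
  | nil => simp
  | cons hadj p ih =>
    intro w hw
    rw [Walk.support_cons, List.mem_cons] at hw
    rcases hw with rfl | hw
    · rfl
    · rw [ih (fun x y hxy => h x y (by simp [hxy])) w hw]
      exact (h _ _ (by simp)).symm

lemma src_mem_of_not_crossing {a : B ⊕ E × ℕ} {c : N.subdivided.Walk a a} (hc : c.IsCycle)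
    {Y : Set B} (hY : ∀ e ∈ trace c, N.src e ∈ Y ↔ N.tgt e ∈ Y) {e e' : E} (he : e ∈ trace c)
    (he' : e' ∈ trace c) (hsrc : N.src e ∈ Y) : N.src e' ∈ Y := by
  let X : Set (B ⊕ E × ℕ) := {w | Sum.elim (· ∈ Y) (fun p => N.src p.1 ∈ Y) w}
  have hpos : ∀ e ∈ trace c, ∀ k, N.pos e k ∈ X ↔ N.src e ∈ Y := by
    intro e he k
    have := hY e he
    simp only [X, pos, Set.mem_ofPred_eq]
    split_ifs <;> simp [this]
  have hX : ∀ x y, s(x, y) ∈ c.edges → (x ∈ X ↔ y ∈ X) := by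
    intro x y hxy
    obtain ⟨e, he, k, hk, heq⟩ := exists_seg_of_mem_cycle hc hxy
    rw [seg, Sym2.eq_iff] at heq
    rcases heq with ⟨rfl, rfl⟩ | ⟨rfl, rfl⟩ <;> rw [hpos e he, hpos e he]
  have hmem := mem_iff_of_edges_not_crossing c hX
  have hsup : ∀ e ∈ trace c, N.pos e 0 ∈ c.support := fun e he =>
    c.fst_mem_support_of_mem_edges (seg_mem_edges hc he (k := 0) (by have := N.two_le_len e; omega))
  rw [← hpos e' he' 0, hmem _ (hsup e' he'), ← hmem _ (hsup e he), hpos e he]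
  exact hsrc

/-- In a cycle every vertex has even degree, so the values of a function at the ends of the
edges add up to zero modulo two. -/
lemma sum_ends_trace {a : B ⊕ E × ℕ} {c : N.subdivided.Walk a a} (hc : c.IsCycle)
    (f : B → ZMod 2) : ∑ e ∈ trace c, (f (N.src e) + f (N.tgt e)) = 0 := by
  classical
  set S := trace c
  let T := S.image N.src ∪ S.image N.tgt
  have h1 : ∀ e ∈ S, N.src e ∈ T := fun e he =>
    Finset.mem_union_left _ (Finset.mem_image_of_mem _ he)
  have h2 : ∀ e ∈ S, N.tgt e ∈ T := fun e he =>
    Finset.mem_union_right _ (Finset.mem_image_of_mem _ he)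
  rw [Finset.sum_add_distrib, ← Finset.sum_fiberwise_of_maps_to h1,
    ← Finset.sum_fiberwise_of_maps_to h2, ← Finset.sum_add_distrib]
  refine Finset.sum_eq_zero fun b _ => ?_
  have h3 : (S.filter fun e => N.src e = b).card + (S.filter fun e => N.tgt e = b).card =
      (N.incident S b).card := by
    rw [incident, Finset.filter_or, Finset.card_union_of_disjoint]
    rw [Finset.disjoint_filter]
    exact fun e _ h h' => N.src_ne_tgt e (h.trans h'.symm)
  have h4 : ∀ g : E → B, ∑ e ∈ S with g e = b, f (g e) = (S.filter fun e => g e = b).card * f b := by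
    intro g
    rw [Finset.sum_congr rfl (g := fun _ => f b) (fun e he => by rw [(Finset.mem_filter.1 he).2])]
    simp
  rw [h4, h4, ← add_mul, ← Nat.cast_add, h3]
  rcases card_incident_trace hc b with h | h <;> rw [h]
  · simp
  · rw [show ((2 : ℕ) : ZMod 2) = 0 from rfl, zero_mul]

/-- A walk along the path that replaces `e` prolongs a path on which a function `ρ` takes its
maximum at the end, provided that `ρ` increases along the path that replaces `e`. -/
lemma exists_prolonged_path {ρ : B ⊕ E × ℕ → ℕ} {e : E} (he : e ∈ N.edges) {j : ℕ}
    (hρ : ∀ k, j ≤ k → k < N.len e → ρ (N.pos e k) < ρ (N.pos e (k + 1)))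
    {a : B ⊕ E × ℕ} {x : B ⊕ E × ℕ} (hx : x = N.pos e j) (p : N.subdivided.Walk a x)
    (hp : p.IsPath)
    (hmax : ∀ w ∈ p.support, ρ w ≤ ρ x) (k : ℕ) (hjk : j ≤ k) (hk : k ≤ N.len e) :
    ∃ q : N.subdivided.Walk a (N.pos e k), q.IsPath ∧ (∀ w ∈ q.support, ρ w ≤ ρ (N.pos e k)) ∧
      q.length = p.length + (k - j) ∧
      ∀ f ∈ q.edges, f ∈ p.edges ∨ ∃ i, j ≤ i ∧ i < k ∧ f = N.seg e i := by
  subst hx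
  induction k, hjk using Nat.le_induction with
  | base => exact ⟨p, hp, hmax, by simp, fun f hf => Or.inl hf⟩
  | succ k hjk ih =>
    obtain ⟨q, hq, hqmax, hlen, hedges⟩ := ih (by omega)
    have hlt := hρ k hjk (by omega)
    refine ⟨q.concat (N.subdivided_adj he (by omega)),
      hq.concat (fun h => absurd (hqmax _ h) (by omega)) _, ?_, ?_, ?_⟩
    · intro w hw
      rw [Walk.support_concat, List.mem_append, List.mem_singleton] at hw
      rcases hw with hw | rfl
      · exact (hqmax w hw).trans hlt.le
      · exact le_rfl
    · rw [Walk.length_concat, hlen]; omega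
    · intro f hf
      rw [Walk.edges_concat, List.concat_eq_append, List.mem_append, List.mem_singleton] at hf
      rcases hf with hf | rfl
      · rcases hedges f hf with h | ⟨i, hi, hik, rfl⟩
        · exact Or.inl h
        · exact Or.inr ⟨i, hi, by omega, rfl⟩
      · exact Or.inr ⟨k, hjk, by omega, rfl⟩

end LengthMultigraph

namespace LengthMultigraph

/-- The combinatorial properties of the edge set of a cycle: all degrees are zero or two, it is
connected, and it satisfies the handshake identity modulo two. -/
structure CycleLike {B E : Type} (N : LengthMultigraph B E) (S : Finset E) : Prop where
  subset : S ⊆ N.edges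
  card_incident : ∀ b, (N.incident S b).card = 0 ∨ (N.incident S b).card = 2
  src_mem : ∀ Y : Set B, (∀ e ∈ S, N.src e ∈ Y ↔ N.tgt e ∈ Y) →
    ∀ e ∈ S, N.src e ∈ Y → ∀ e' ∈ S, N.src e' ∈ Y
  sum_ends : ∀ f : B → ZMod 2, ∑ e ∈ S, (f (N.src e) + f (N.tgt e)) = 0

lemma cycleLike_trace {B E : Type} {N : LengthMultigraph B E} {a : B ⊕ E × ℕ}
    {c : N.subdivided.Walk a a} (hc : c.IsCycle) : N.CycleLike (trace c) where
  subset _ he := (mem_trace.1 he).1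
  card_incident := card_incident_trace hc
  src_mem _ hY _ he hsrc _ he' := src_mem_of_not_crossing hc hY he he' hsrc
  sum_ends := sum_ends_trace hc

variable {B E : Type} {N : LengthMultigraph B E} {S T : Finset E}

lemma mem_incident {b : B} {e : E} :
    e ∈ N.incident S b ↔ e ∈ S ∧ (N.src e = b ∨ N.tgt e = b) := by
  classical simp [incident]

lemma CycleLike.card_eq_two (hS : N.CycleLike S) {b : B} {e : E} (he : e ∈ N.incident S b) :
    (N.incident S b).card = 2 :=
  (hS.card_incident b).resolve_left (Finset.card_ne_zero_of_mem he)

/-- Disjoint cycles do not meet in a vertex of degree at most three. -/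
lemma CycleLike.not_incident_of_disjoint (hS : N.CycleLike S) (hT : N.CycleLike T)
    (hd : Disjoint S T) {b : B} (hb : (N.incident N.edges b).card ≤ 3) {e f : E}
    (he : e ∈ N.incident S b) : f ∉ N.incident T b := by
  classical
  intro hf
  have hdisj : Disjoint (N.incident S b) (N.incident T b) :=
    Finset.disjoint_left.2 fun g h h' =>
      Finset.disjoint_left.1 hd (mem_incident.1 h).1 (mem_incident.1 h').1
  have hle : (N.incident S b ∪ N.incident T b).card ≤ (N.incident N.edges b).card := by
    refine Finset.card_le_card fun g hg => ?_
    rcases Finset.mem_union.1 hg with h | h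
    · exact mem_incident.2 ⟨hS.subset (mem_incident.1 h).1, (mem_incident.1 h).2⟩
    · exact mem_incident.2 ⟨hT.subset (mem_incident.1 h).1, (mem_incident.1 h).2⟩
  rw [Finset.card_union_of_disjoint hdisj, hS.card_eq_two he, hT.card_eq_two hf] at hle
  omega

end LengthMultigraph

/-- The vertices of the triangular wall: the cell in row `i` and column `j` consists of `x i j`
and `y i j`, and `u`, `v` are the two additional vertices. -/
inductive WallVertex
  | u | v
  | x (i j : ℕ)
  | y (i j : ℕ)
  deriving DecidableEq

/-- The edges of the triangular wall: `row i j` and `col i j` enter the cell in row `i` and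
column `j` from the left and from above, `cell i j` joins the two vertices of that cell, and
the edges `link k` join `u` and `v`. -/
inductive WallEdge
  | link (k : ℕ)
  | row (i j : ℕ)
  | col (i j : ℕ)
  | cell (i j : ℕ)
  deriving DecidableEq

namespace TriangularWall

open WallVertex WallEdge LengthMultigraph

/-- The first end of an edge. -/
def src : WallEdge → WallVertex
  | link _ => v
  | row _ 0 => u
  | row i (j + 1) => y i j
  | col i j => y (i - 1) j
  | cell i j => x i j

/-- The second end of an edge; the columns of the wall with `n` rows end in `v`. -/
def tgt (n : ℕ) : WallEdge → WallVertex
  | link _ => u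
  | row i j => x i j
  | col i j => if i = n then v else x i j
  | cell i j => y i j

/-- The length of an edge. Modulo `m`, it is `-1` for the edges between `u` and `v`, `1` for the
diagonal cells and `0` otherwise. -/
def len (m : ℕ) : WallEdge → ℕ
  | link _ => 2 * m - 1
  | cell i j => if i = j then m + 1 else m
  | _ => m

/-- The edges of the wall with `n` rows. -/
def edges (n : ℕ) : Finset WallEdge :=
  (Finset.range n).image link ∪
    ((Finset.range n ×ˢ Finset.range n).filter fun p => p.2 ≤ p.1).image (fun p => row p.1 p.2) ∪
    ((Finset.range (n + 1) ×ˢ Finset.range n).filter fun p => p.2 < p.1).image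
      (fun p => col p.1 p.2) ∪
    ((Finset.range n ×ˢ Finset.range n).filter fun p => p.2 ≤ p.1).image (fun p => cell p.1 p.2)

@[simp] lemma link_mem_edges {n k : ℕ} : link k ∈ edges n ↔ k < n := by simp [edges]

@[simp] lemma row_mem_edges {n i j : ℕ} : row i j ∈ edges n ↔ j ≤ i ∧ i < n := by
  simp [edges]; omega

@[simp] lemma col_mem_edges {n i j : ℕ} : col i j ∈ edges n ↔ j < i ∧ i ≤ n := by
  simp [edges]; omega

@[simp] lemma cell_mem_edges {n i j : ℕ} : cell i j ∈ edges n ↔ j ≤ i ∧ i < n := by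
  simp [edges]; omega

/-- The triangular wall with `n` rows. -/
def wall (m n : ℕ) (hm : 2 < m) : LengthMultigraph WallVertex WallEdge where
  src := src
  tgt := tgt n
  len := len m
  edges := edges n
  two_le_len e := by
    cases e <;> simp only [len] <;> (try split_ifs) <;> omega
  src_ne_tgt e := by
    rcases e with k | ⟨i, _ | j⟩ | ⟨i, j⟩ | ⟨i, j⟩ <;> simp only [src, tgt] <;> (try split_ifs) <;>
      simp

variable {m n : ℕ} {hm : 2 < m} {S T : Finset WallEdge}

@[simp] lemma src_wall : (wall m n hm).src = src := rfl
@[simp] lemma tgt_wall : (wall m n hm).tgt = tgt n := rfl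
@[simp] lemma len_wall : (wall m n hm).len = len m := rfl
@[simp] lemma edges_wall : (wall m n hm).edges = edges n := rfl

lemma mem_incident_x {i j : ℕ} (hi : i < n) (hS : S ⊆ edges n) {e : WallEdge} :
    e ∈ (wall m n hm).incident S (x i j) ↔
      e ∈ S ∧ e ∈ ({row i j, col i j, cell i j} : Finset WallEdge) := by
  rw [mem_incident, and_congr_right_iff]
  intro he
  have he' := hS he
  rcases e with k | ⟨a, _ | b⟩ | ⟨a, b⟩ | ⟨a, b⟩ <;> simp [src, tgt] at he' ⊢
  all_goals (try split_ifs) <;> simp <;> omega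

lemma mem_incident_y {i j : ℕ} (hS : S ⊆ edges n) {e : WallEdge} :
    e ∈ (wall m n hm).incident S (y i j) ↔
      e ∈ S ∧ e ∈ ({row i (j + 1), col (i + 1) j, cell i j} : Finset WallEdge) := by
  rw [mem_incident, and_congr_right_iff]
  intro he
  have he' := hS he
  rcases e with k | ⟨a, _ | b⟩ | ⟨a, b⟩ | ⟨a, b⟩ <;> simp [src, tgt] at he' ⊢
  all_goals (try split_ifs) <;> simp <;> omega

/-- The indicator function of `S` modulo two. -/
def ind (S : Finset WallEdge) (e : WallEdge) : ZMod 2 := if e ∈ S then 1 else 0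

lemma sum_ind_eq_zero (hS : (wall m n hm).CycleLike S) {b : WallVertex} {s : Finset WallEdge}
    (h : ∀ e, e ∈ (wall m n hm).incident S b ↔ e ∈ S ∧ e ∈ s) : ∑ e ∈ s, ind S e = 0 := by
  have h1 : (wall m n hm).incident S b = s.filter (· ∈ S) := by
    ext e; rw [h, Finset.mem_filter, and_comm]
  have h2 := hS.card_incident b
  rw [h1] at h2
  simp only [ind]
  rw [← Finset.natCast_card_filter]
  rcases h2 with h2 | h2 <;> rw [h2] <;> rfl

lemma ind_x (hS : (wall m n hm).CycleLike S) {i : ℕ} (hi : i < n) (j : ℕ) :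
    ind S (row i j) + (ind S (col i j) + ind S (cell i j)) = 0 := by
  have := sum_ind_eq_zero hS (fun e => mem_incident_x (j := j) hi hS.subset (e := e))
  simpa using this

lemma ind_y (hS : (wall m n hm).CycleLike S) (i j : ℕ) :
    ind S (row i (j + 1)) + (ind S (col (i + 1) j) + ind S (cell i j)) = 0 := by
  have := sum_ind_eq_zero hS (fun e => mem_incident_y (i := i) (j := j) hS.subset (e := e))
  simpa using this

/-- The parity of the number of edges of `S` that enter column `j` from the left in one of the
first `i` rows. -/
def crossings (S : Finset WallEdge) (i j : ℕ) : ZMod 2 := ∑ k ∈ Finset.range i, ind S (row k j)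

lemma crossings_succ (i j : ℕ) :
    crossings S (i + 1) j = crossings S i j + ind S (row i j) := Finset.sum_range_succ _ _

lemma ind_eq_zero {e : WallEdge} (h : e ∉ S) : ind S e = 0 := if_neg h

lemma crossings_eq_zero (hS : S ⊆ edges n) {i j : ℕ} (h : i ≤ j) : crossings S i j = 0 := by
  refine Finset.sum_eq_zero fun k hk => ind_eq_zero fun h' => ?_
  have := row_mem_edges.1 (hS h')
  have := Finset.mem_range.1 hk
  omega

lemma crossings_add (hS : (wall m n hm).CycleLike S) {i : ℕ} (hi : i ≤ n) (j : ℕ) :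
    crossings S i j + crossings S i (j + 1) = ind S (col i j) := by
  induction i with
  | zero =>
    rw [ind_eq_zero]
    · simp [crossings]
    · intro h
      have := hS.subset h
      simp at this
  | succ i ih =>
    have h1 := ih (by omega)
    have h2 := ind_x hS (show i < n by omega) j
    have h3 := ind_y hS i j
    rw [crossings_succ, crossings_succ]
    have h4 : (2 : ZMod 2) = 0 := rfl
    linear_combination h1 + h2 + h3 - (ind S (cell i j) + ind S (col (i + 1) j)) * h4

/-- Below the last row, the crossings detect the column in which `S` leaves the wall. -/
lemma crossings_last (hS : (wall m n hm).CycleLike S) {p : ℕ} (hp : col n p ∈ S)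
    (huniq : ∀ j, col n j ∈ S → j = p) (j : ℕ) :
    crossings S n j = if j ≤ p then 1 else 0 := by
  have hpn : p < n := (col_mem_edges.1 (hS.subset hp)).1
  suffices ∀ d j, n ≤ j + d → crossings S n j = if j ≤ p then 1 else 0 from this n j (by omega)
  intro d
  induction d with
  | zero =>
    intro j hj
    rw [crossings_eq_zero hS.subset (by omega), if_neg (by omega)]
  | succ d ih =>
    intro j hj
    have h1 := crossings_add hS le_rfl j
    rw [ih (j + 1) (by omega)] at h1
    have h4 : (2 : ZMod 2) = 0 := rfl
    by_cases hjp : j = p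
    · subst hjp
      rw [if_neg (by omega), ind, if_pos hp] at h1
      rw [if_pos le_rfl]
      simpa using h1
    · rw [ind_eq_zero (fun h => hjp (huniq j h))] at h1
      by_cases hlt : j < p
      · rw [if_pos (by omega)] at h1
        rw [if_pos (by omega)]
        linear_combination h1 - h4
      · rw [if_neg (by omega)] at h1
        rw [if_neg (by omega)]
        simpa using h1

lemma card_incident_x_le {i : ℕ} (hi : i < n) (j : ℕ) :
    ((wall m n hm).incident (edges n) (x i j)).card ≤ 3 :=
  (Finset.card_le_card fun _ he => ((mem_incident_x hi subset_rfl).1 he).2).trans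
    Finset.card_le_three

lemma card_incident_y_le (i j : ℕ) :
    ((wall m n hm).incident (edges n) (y i j)).card ≤ 3 :=
  (Finset.card_le_card fun _ he => ((mem_incident_y subset_rfl).1 he).2).trans
    Finset.card_le_three

lemma ind_row_eq_zero (hS : (wall m n hm).CycleLike S) (hT : (wall m n hm).CycleLike T)
    (hd : Disjoint S T) {i j : ℕ} (hi : i < n) {e : WallEdge} (he : e ∈ T)
    (he' : e ∈ ({row i j, col i j, cell i j} : Finset WallEdge)) : ind S (row i j) = 0 := by
  refine ind_eq_zero fun h => ?_
  exact hS.not_incident_of_disjoint hT hd (card_incident_x_le hi j)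
    ((mem_incident_x hi hS.subset).2 ⟨h, by simp⟩) ((mem_incident_x hi hT.subset).2 ⟨he, he'⟩)

lemma ind_col_eq_zero (hS : (wall m n hm).CycleLike S) (hT : (wall m n hm).CycleLike T)
    (hd : Disjoint S T) {i j : ℕ} {e : WallEdge} (he : e ∈ T)
    (he' : e ∈ ({row i (j + 1), col (i + 1) j, cell i j} : Finset WallEdge)) :
    ind S (col (i + 1) j) = 0 := by
  refine ind_eq_zero fun h => ?_
  exact hS.not_incident_of_disjoint hT hd (card_incident_y_le i j)
    ((mem_incident_y hS.subset).2 ⟨h, by simp⟩) ((mem_incident_y hT.subset).2 ⟨he, he'⟩)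

lemma link_mem_incident_u {k : ℕ} : link k ∈ (wall m n hm).incident S u ↔ link k ∈ S := by
  simp [mem_incident, tgt]

lemma link_mem_incident_v {k : ℕ} : link k ∈ (wall m n hm).incident S v ↔ link k ∈ S := by
  simp [mem_incident, src]

lemma exists_of_mem_incident_u {e : WallEdge} (he : e ∈ (wall m n hm).incident S u) :
    (∃ k, e = link k) ∨ ∃ i, e = row i 0 := by
  rw [mem_incident] at he
  rcases e with k | ⟨a, _ | b⟩ | ⟨a, b⟩ | ⟨a, b⟩ <;> simp [src, tgt] at he ⊢
  split_ifs at he <;> simp at he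

lemma exists_of_mem_incident_v {e : WallEdge} (he : e ∈ (wall m n hm).incident S v) :
    (∃ k, e = link k) ∨ ∃ j, e = col n j := by
  rw [mem_incident] at he
  rcases e with k | ⟨a, _ | b⟩ | ⟨a, b⟩ | ⟨a, b⟩ <;> simp [src, tgt] at he ⊢
  exact he.2

lemma link_unique (hS : (wall m n hm).CycleLike S) (hdvd : m ∣ ∑ e ∈ S, len m e) {k k' : ℕ}
    (hk : link k ∈ S) (hk' : link k' ∈ S) : k' = k := by
  by_contra hne
  have hpair : ({link k, link k'} : Finset WallEdge).card = 2 :=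
    Finset.card_pair (by simpa using Ne.symm hne)
  have hu : {link k, link k'} = (wall m n hm).incident S u := by
    refine Finset.eq_of_subset_of_card_le ?_ ?_
    · simp [Finset.insert_subset_iff, link_mem_incident_u, hk, hk']
    · rw [hpair, hS.card_eq_two (link_mem_incident_u.2 hk)]
  have hv : {link k, link k'} = (wall m n hm).incident S v := by
    refine Finset.eq_of_subset_of_card_le ?_ ?_
    · simp [Finset.insert_subset_iff, link_mem_incident_v, hk, hk']
    · rw [hpair, hS.card_eq_two (link_mem_incident_v.2 hk)]
  have hlink : ∀ e ∈ ({link k, link k'} : Finset WallEdge), src e = v ∧ tgt n e = u := by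
    simp [src, tgt]
  have hmem : ∀ e ∈ S, src e = u ∨ src e = v ∨ tgt n e = u ∨ tgt n e = v →
      e ∈ ({link k, link k'} : Finset WallEdge) := by
    rintro e he (h | h | h | h)
    · rw [hu]; exact mem_incident.2 ⟨he, Or.inl h⟩
    · rw [hv]; exact mem_incident.2 ⟨he, Or.inl h⟩
    · rw [hu]; exact mem_incident.2 ⟨he, Or.inr h⟩
    · rw [hv]; exact mem_incident.2 ⟨he, Or.inr h⟩
  have hconn := hS.src_mem {u, v} (by
    intro e he
    simp only [src_wall, tgt_wall, Set.mem_insert_iff, Set.mem_singleton_iff]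
    constructor
    · intro h
      exact Or.inl (hlink e (hmem e he (by tauto))).2
    · intro h
      exact Or.inr (hlink e (hmem e he (by tauto))).1) (link k) hk (by simp [src])
  have hSeq : S = {link k, link k'} := by
    refine Finset.Subset.antisymm (fun e he => hmem e he ?_) ?_
    · have := hconn e he
      simp only [src_wall, Set.mem_insert_iff, Set.mem_singleton_iff] at this
      tauto
    · simp [Finset.insert_subset_iff, hk, hk']
  rw [hSeq, Finset.sum_pair (by simpa using Ne.symm hne)] at hdvd
  simp only [len] at hdvd
  have h2 : m ∣ 2 := by
    have h4 : m ∣ 4 * m := Dvd.intro_left _ rfl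
    have := Nat.dvd_sub h4 hdvd
    rwa [show 4 * m - (2 * m - 1 + (2 * m - 1)) = 2 by omega] at this
  have := Nat.le_of_dvd (by norm_num) h2
  omega

lemma exists_diagonal (hS : (wall m n hm).CycleLike S) (hdvd : m ∣ ∑ e ∈ S, len m e) {k : ℕ}
    (hk : link k ∈ S) : ∃ j, cell j j ∈ S := by
  by_contra! hno
  have hlink := fun k' => link_unique hS hdvd (k' := k') hk
  rw [← Finset.add_sum_erase S _ hk] at hdvd
  have hrest : m ∣ ∑ e ∈ S.erase (link k), len m e := by
    refine Finset.dvd_sum fun e he => ?_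
    obtain ⟨hne, he⟩ := Finset.mem_erase.1 he
    rcases e with k' | ⟨i, j⟩ | ⟨i, j⟩ | ⟨i, j⟩
    · exact absurd (congrArg link (hlink k' he)) hne
    · simp [len]
    · simp [len]
    · have : i ≠ j := by rintro rfl; exact hno i he
      simp [len, this]
  have h1 := (Nat.dvd_add_left hrest).1 hdvd
  simp only [len] at h1
  have h2 : m ∣ 1 := by
    have := Nat.dvd_sub (Dvd.intro_left 2 rfl : m ∣ 2 * m) h1
    rwa [show 2 * m - (2 * m - 1) = 1 by omega] at this
  have := Nat.le_of_dvd (by norm_num) h2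
  omega

lemma exists_unique_row (hS : (wall m n hm).CycleLike S) (hdvd : m ∣ ∑ e ∈ S, len m e) {k : ℕ}
    (hk : link k ∈ S) : ∃ i, row i 0 ∈ S ∧ ∀ i', row i' 0 ∈ S → i' = i := by
  have hmem := (link_mem_incident_u (hm := hm) (n := n)).2 hk
  have hcard := Finset.card_erase_of_mem hmem
  rw [hS.card_eq_two hmem] at hcard
  obtain ⟨b, hb⟩ := Finset.card_eq_one.1 hcard
  have hb' : b ∈ ((wall m n hm).incident S u).erase (link k) := by simp [hb]
  obtain ⟨hne, hbi⟩ := Finset.mem_erase.1 hb'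
  rcases exists_of_mem_incident_u hbi with ⟨k', rfl⟩ | ⟨i, rfl⟩
  · exact absurd (congrArg link (link_unique hS hdvd hk (link_mem_incident_u.1 hbi))) hne
  · refine ⟨i, (mem_incident.1 hbi).1, fun i' hi' => ?_⟩
    have : row i' 0 ∈ ((wall m n hm).incident S u).erase (link k) := by
      simp [mem_incident, hi', src]
    rw [hb] at this
    simpa using this

lemma exists_unique_col (hS : (wall m n hm).CycleLike S) (hdvd : m ∣ ∑ e ∈ S, len m e) {k : ℕ}
    (hk : link k ∈ S) : ∃ j, col n j ∈ S ∧ ∀ j', col n j' ∈ S → j' = j := by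
  have hmem := (link_mem_incident_v (hm := hm) (n := n)).2 hk
  have hcard := Finset.card_erase_of_mem hmem
  rw [hS.card_eq_two hmem] at hcard
  obtain ⟨b, hb⟩ := Finset.card_eq_one.1 hcard
  have hb' : b ∈ ((wall m n hm).incident S v).erase (link k) := by simp [hb]
  obtain ⟨hne, hbi⟩ := Finset.mem_erase.1 hb'
  rcases exists_of_mem_incident_v hbi with ⟨k', rfl⟩ | ⟨j, rfl⟩
  · exact absurd (congrArg link (link_unique hS hdvd hk (link_mem_incident_v.1 hbi))) hne
  · refine ⟨j, (mem_incident.1 hbi).1, fun j' hj' => ?_⟩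
    have : col n j' ∈ ((wall m n hm).incident S v).erase (link k) := by
      simp [mem_incident, hj', tgt]
    rw [hb] at this
    simpa using this

/-- The parity of the number of edges of `S` above a vertex of the wall. -/
def height (S : Finset WallEdge) : WallVertex → ZMod 2
  | u => 1
  | v => 1
  | x i j => crossings S (i + 1) j
  | y i j => crossings S (i + 1) j

/-- A cycle `T` disjoint from `S` stays on one side of `S` within the wall. -/
lemma height_src_eq_height_tgt (hS : (wall m n hm).CycleLike S) (hT : (wall m n hm).CycleLike T)
    (hd : Disjoint S T) {e : WallEdge} (he : e ∈ T) (hrow : ∀ i, e ≠ row i 0)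
    (hcol : ∀ j, e ≠ col n j) : height S (src e) = height S (tgt n e) := by
  have he' := hT.subset he
  rcases e with k | ⟨i, _ | j⟩ | ⟨i, j⟩ | ⟨i, j⟩
  · rfl
  · exact absurd rfl (hrow i)
  · rw [edges_wall, row_mem_edges] at he'
    have h1 := crossings_add hS (show i + 1 ≤ n by omega) j
    rw [ind_col_eq_zero hS hT hd he (by simp)] at h1
    have h4 : (2 : ZMod 2) = 0 := rfl
    simp only [src, tgt, height]
    linear_combination h1 - crossings S (i + 1) (j + 1) * h4
  · rw [edges_wall, col_mem_edges] at he'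
    have hin : i ≠ n := by rintro rfl; exact hcol j rfl
    simp only [src, tgt, hin, if_false, height]
    rw [Nat.sub_add_cancel (by omega), crossings_succ,
      ind_row_eq_zero hS hT hd (by omega) he (by simp), add_zero]
  · rfl

lemma col_lt_col (hS : (wall m n hm).CycleLike S) (hT : (wall m n hm).CycleLike T)
    (hd : Disjoint S T) {k d i p q : ℕ} (hk : link k ∈ T) (hdiag : cell d d ∈ T)
    (hi : row i 0 ∈ T) (hi' : ∀ i', row i' 0 ∈ T → i' = i)
    (hq : col n q ∈ T) (hq' : ∀ j, col n j ∈ T → j = q)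
    (hp : col n p ∈ S) (hp' : ∀ j, col n j ∈ S → j = p) : p < q := by
  have hn : n - 1 + 1 = n := by have := (col_mem_edges.1 (hT.subset hq)); omega
  have h4 : (2 : ZMod 2) = 0 := rfl
  by_contra! hle
  have hone := crossings_last hS hp hp' q
  rw [if_pos hle] at hone
  have hsum := hT.sum_ends (height S)
  rw [Finset.sum_eq_add (row i 0) (col n q) (by simp)] at hsum
  rotate_left
  · rintro e he ⟨h1, h2⟩
    simp only [src_wall, tgt_wall]
    rw [height_src_eq_height_tgt hS hT hd he, CharTwo.add_self_eq_zero]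
    · rintro i' rfl; exact h1 (by rw [hi' i' he])
    · rintro j rfl; exact h2 (by rw [hq' j he])
  · exact fun h => absurd hi h
  · exact fun h => absurd hq h
  simp only [src_wall, tgt_wall, src, tgt, if_true, height, hn, hone] at hsum
  have hleft : crossings S (i + 1) 0 = 1 := by linear_combination hsum - 2 * h4
  have hconn := hT.src_mem {b | height S b = 0} (by
    intro e he
    simp only [src_wall, tgt_wall, Set.mem_ofPred_eq]
    by_cases hr : ∃ i', e = row i' 0
    · obtain ⟨i', rfl⟩ := hr
      rw [hi' i' he]
      simp only [src, tgt, height, hleft]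
    by_cases hc : ∃ j, e = col n j
    · obtain ⟨j, rfl⟩ := hc
      rw [hq' j he]
      simp only [src, tgt, if_true, height, hn, hone]
    · rw [height_src_eq_height_tgt hS hT hd he (by simpa using hr) (by simpa using hc)])
    (cell d d) hdiag (by
      have hdn := (cell_mem_edges.1 (hT.subset hdiag)).2
      simp only [src_wall, src, height, Set.mem_ofPred_eq]
      rw [crossings_succ, crossings_eq_zero hS.subset le_rfl,
        ind_row_eq_zero hS hT hd hdn hdiag (by simp), add_zero])
    (link k) hk
  simp [src, height] at hconn

theorem not_disjoint (hS : (wall m n hm).CycleLike S) (hT : (wall m n hm).CycleLike T)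
    (hmS : m ∣ ∑ e ∈ S, len m e) (hmT : m ∣ ∑ e ∈ T, len m e) {k k' : ℕ} (hk : link k ∈ S)
    (hk' : link k' ∈ T) : ¬ Disjoint S T := by
  intro hd
  obtain ⟨d, hdS⟩ := exists_diagonal hS hmS hk
  obtain ⟨d', hdT⟩ := exists_diagonal hT hmT hk'
  obtain ⟨i, hi, hi'⟩ := exists_unique_row hS hmS hk
  obtain ⟨i₂, hi₂, hi₂'⟩ := exists_unique_row hT hmT hk'
  obtain ⟨p, hp, hp'⟩ := exists_unique_col hS hmS hk
  obtain ⟨q, hq, hq'⟩ := exists_unique_col hT hmT hk'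
  have h1 := col_lt_col hS hT hd hk' hdT hi₂ hi₂' hq hq' hp hp'
  have h2 := col_lt_col hT hS hd.symm hk hdS hi hi' hp hp' hq hq'
  omega

end TriangularWall

namespace TriangularWall

open WallVertex WallEdge LengthMultigraph SimpleGraph

variable {m n : ℕ} {hm : 2 < m}

/-- A rank function on the vertices that increases along every edge of the wall. -/
def rank (n : ℕ) : WallVertex → ℕ
  | u => 0
  | x i j => 2 * (i + j) + 1
  | y i j => 2 * (i + j) + 2
  | v => 4 * n + 2

/-- An extension of `rank` to the subdivided wall. -/
def subdividedRank (m n : ℕ) : WallVertex ⊕ WallEdge × ℕ → ℕ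
  | .inl b => 2 * m * (rank n b + 1)
  | .inr (link _, k) => k
  | .inr (e, k) => 2 * m * (rank n (src e) + 1) + k

/-- An edge is not one of the edges between `u` and `v`. -/
def NotLink (e : WallEdge) : Prop := ∀ k, e ≠ link k

lemma rank_src_lt_rank_tgt {e : WallEdge} (he : e ∈ edges n) (hl : NotLink e) :
    rank n (src e) < rank n (tgt n e) := by
  rcases e with k | ⟨i, _ | j⟩ | ⟨i, j⟩ | ⟨i, j⟩
  · exact absurd rfl (hl k)
  all_goals simp only [src, tgt, rank, row_mem_edges, col_mem_edges] at he ⊢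
  all_goals (try split_ifs) <;> (try dsimp only) <;> omega

lemma len_le {e : WallEdge} (hl : NotLink e) : len m e ≤ m + 1 := by
  rcases e with k | ⟨i, j⟩ | ⟨i, j⟩ | ⟨i, j⟩
  · exact absurd rfl (hl k)
  all_goals simp only [len]
  all_goals (try split_ifs) <;> omega

lemma subdividedRank_pos {e : WallEdge} (hl : NotLink e) {k : ℕ} (hk : k < len m e) :
    subdividedRank m n ((wall m n hm).pos e k) = 2 * m * (rank n (src e) + 1) + k := by
  rcases Nat.eq_zero_or_pos k with rfl | h0
  · simp [subdividedRank]
  · rw [pos_inner _ h0 hk]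
    rcases e with k | ⟨i, j⟩ | ⟨i, j⟩ | ⟨i, j⟩
    · exact absurd rfl (hl k)
    all_goals rfl

lemma subdividedRank_lt {e : WallEdge} (he : e ∈ edges n) (hl : NotLink e) {k : ℕ}
    (hk : k < len m e) : subdividedRank m n ((wall m n hm).pos e k) <
      subdividedRank m n ((wall m n hm).pos e (k + 1)) := by
  rw [subdividedRank_pos hl hk]
  rcases Nat.lt_or_eq_of_le (Nat.succ_le_of_lt hk) with h | h
  · rw [subdividedRank_pos hl h]; omega
  · have h' : (wall m n hm).pos e (k + 1) = .inl (tgt n e) := by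
      rw [show k + 1 = (wall m n hm).len e from h, pos_len]; rfl
    rw [h']
    have h1 := rank_src_lt_rank_tgt he hl
    have h2 := len_le (m := m) hl
    have h3 : 2 * m * (rank n (src e) + 1 + 1) ≤ 2 * m * (rank n (tgt n e) + 1) :=
      Nat.mul_le_mul_left _ (by omega)
    simp only [subdividedRank]
    rw [mul_add _ (rank n (src e) + 1)] at h3
    omega

lemma subdividedRank_link_lt {i k : ℕ} (h0 : 1 ≤ k) (hk : k < len m (link i)) :
    subdividedRank m n ((wall m n hm).pos (link i) k) <
      subdividedRank m n ((wall m n hm).pos (link i) (k + 1)) := by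
  rw [pos_inner _ h0 hk]
  rcases Nat.lt_or_eq_of_le (Nat.succ_le_of_lt hk) with h | h
  · rw [pos_inner _ (by omega) h]; simp [subdividedRank]
  · have h' : (wall m n hm).pos (link i) (k + 1) = .inl u := by
      rw [show k + 1 = (wall m n hm).len (link i) from h, pos_len]; rfl
    rw [h']
    simp only [subdividedRank, rank]
    simp only [len] at hk
    omega

/-- The indices of the closed curves that use a given edge, where the `i`-th curve consists of
`link i`, row `i` and column `i`. -/
def curves : WallEdge → Finset ℕ
  | link k => {k}
  | row i _ => {i}
  | col _ j => {j}
  | cell i j => {i, j}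

lemma card_curves_le (e : WallEdge) : (curves e).card ≤ 2 := by
  cases e
  case cell => exact Finset.card_le_two
  all_goals simp [curves]

/-- The `i`-th curve without its first edge contains a path to `b` whose length is `-r`
modulo `m`. -/
def Reaches (m n : ℕ) (hm : 2 < m) (i : ℕ) (b : WallVertex) (r : ℕ) : Prop :=
  ∃ q : (wall m n hm).subdivided.Walk ((wall m n hm).pos (link i) 1) (.inl b), q.IsPath ∧
    (∀ w ∈ q.support, subdividedRank m n w ≤ subdividedRank m n (.inl b)) ∧ m ∣ q.length + r ∧
    ∀ f ∈ q.edges, ∃ e k, i ∈ curves e ∧ k < len m e ∧ (e = link i → 1 ≤ k) ∧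
      f = (wall m n hm).seg e k

lemma reaches_u {i : ℕ} (hi : i < n) : Reaches m n hm i u 2 := by
  obtain ⟨q, hq, hmax, hlen, hedges⟩ := exists_prolonged_path (N := wall m n hm)
    (ρ := subdividedRank m n) (e := link i) (by simpa using hi) (j := 1)
    (fun k h0 hk => subdividedRank_link_lt h0 hk) rfl .nil .nil
    (by simp) (len m (link i)) (by simp only [len]; omega) le_rfl
  have hend : (wall m n hm).pos (link i) (len m (link i)) = .inl u := pos_len _ _
  have hmax' : ∀ w ∈ q.support, subdividedRank m n w ≤ subdividedRank m n (.inl u) :=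
    fun w hw => (hmax w hw).trans_eq (congrArg _ hend)
  refine ⟨q.copy rfl hend, by simpa using hq, by simpa using hmax', ?_, ?_⟩
  · rw [Walk.length_copy, hlen]
    simp only [Walk.length_nil, len]
    exact ⟨2, by omega⟩
  · intro f hf
    rw [Walk.edges_copy] at hf
    rcases hedges f hf with h | ⟨k, h0, hk, rfl⟩
    · simp at h
    · exact ⟨link i, k, by simp [curves], hk, fun _ => h0, rfl⟩

lemma Reaches.step {i r r' : ℕ} {e : WallEdge} (h : Reaches m n hm i (src e) r)
    (he : e ∈ edges n) (hl : NotLink e) (hc : i ∈ curves e) (hr : m + r = len m e + r') :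
    Reaches m n hm i (tgt n e) r' := by
  obtain ⟨p, hp, hpmax, ⟨t, ht⟩, hpe⟩ := h
  obtain ⟨q, hq, hmax, hlen, hedges⟩ := exists_prolonged_path (N := wall m n hm)
    (ρ := subdividedRank m n) (e := e) he (j := 0)
    (fun k _ hk => subdividedRank_lt he hl hk) (pos_zero _ _).symm p hp
    hpmax (len m e) (Nat.zero_le _) le_rfl
  have hend : (wall m n hm).pos e (len m e) = .inl (tgt n e) := pos_len _ _
  have hmax' : ∀ w ∈ q.support, subdividedRank m n w ≤ subdividedRank m n (.inl (tgt n e)) :=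
    fun w hw => (hmax w hw).trans_eq (congrArg _ hend)
  refine ⟨q.copy rfl hend, by simpa using hq, by simpa using hmax', ?_, ?_⟩
  · have hlen' : q.length = p.length + (len m e - 0) := hlen
    rw [Walk.length_copy, hlen']
    exact ⟨t + 1, by rw [mul_add, ← ht]; omega⟩
  · intro f hf
    rw [Walk.edges_copy] at hf
    rcases hedges f hf with h | ⟨k, -, hk, rfl⟩
    · exact hpe f h
    · exact ⟨e, k, hc, hk, fun h => absurd h (hl i), rfl⟩

lemma reaches_x {i : ℕ} (hi : i < n) (j : ℕ) (hj : j ≤ i) : Reaches m n hm i (x i j) 2 := by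
  induction j with
  | zero =>
    exact (reaches_u hi).step (e := row i 0) (by simpa using hi) (fun _ => by simp)
      (by simp [curves]) rfl
  | succ j ih =>
    have h1 := (ih (by omega)).step (e := cell i j) (r' := 2) (by simp; omega)
      (fun _ => by simp) (by simp [curves]) (by simp [len, show i ≠ j by omega])
    exact h1.step (e := row i (j + 1)) (by simp; omega) (fun _ => by simp) (by simp [curves]) rfl

lemma reaches_y {i a : ℕ} (ha : a < n) (hia : i ≤ a) : Reaches m n hm i (y a i) 1 := by
  induction a, hia using Nat.le_induction with
  | base =>
    exact (reaches_x ha i le_rfl).step (e := cell i i) (by simpa using ha) (fun _ => by simp)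
      (by simp [curves]) (by simp [len])
  | succ a hia ih =>
    have h1 := (ih (by omega)).step (e := col (a + 1) i) (r' := 1) (by simp; omega)
      (fun _ => by simp) (by simp [curves]) rfl
    rw [tgt, if_neg (by omega)] at h1
    exact h1.step (e := cell (a + 1) i) (by simp; omega) (fun _ => by simp) (by simp [curves])
      (by simp [len, show a + 1 ≠ i by omega])

lemma reaches_v {i : ℕ} (hi : i < n) : Reaches m n hm i v 1 := by
  have h1 := (reaches_y (m := m) (n := n) (hm := hm) (a := n - 1) (i := i) (by omega) (by omega)).step
    (e := col n i) (r' := 1) (by simp; omega) (fun _ => by simp) (by simp [curves]) rfl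
  rwa [tgt, if_pos rfl] at h1

/-- The inner vertices of the paths that replace the edges between `u` and `v`. -/
def linkVertices : Set (WallVertex ⊕ WallEdge × ℕ) := {w | ∃ k t, w = .inr (link k, t)}

lemma exists_cycle (hm : 2 < m) {i : ℕ} (hi : i < n) :
    ∃ (w : WallVertex ⊕ WallEdge × ℕ) (c : (wall m n hm).subdivided.Walk w w), c.IsCycle ∧
      m ∣ c.length ∧ (∃ a ∈ linkVertices, a ∈ c.support) ∧
      ∀ f ∈ c.edges, ∃ e k, i ∈ curves e ∧ k < len m e ∧ f = (wall m n hm).seg e k := by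
  obtain ⟨q, hq, -, hlen, hedges⟩ := reaches_v (hm := hm) hi
  have h0 : 0 < len m (link i) := by simp only [len]; omega
  have hadj : (wall m n hm).subdivided.Adj (.inl v) ((wall m n hm).pos (link i) 1) := by
    have := (wall m n hm).subdivided_adj (e := link i) (by simpa using hi) h0
    rwa [pos_zero] at this
  have hseg : s(.inl v, (wall m n hm).pos (link i) 1) = (wall m n hm).seg (link i) 0 := by
    rw [seg, pos_zero]; rfl
  refine ⟨_, .cons hadj q, (Walk.cons_isCycle_iff q hadj).2 ⟨hq, fun hmem => ?_⟩, hlen, ?_, ?_⟩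
  · obtain ⟨e, k, -, hk, hne, heq⟩ := hedges _ hmem
    rw [hseg] at heq
    obtain ⟨rfl, rfl⟩ := (wall m n hm).seg_injective h0 hk heq
    exact absurd (hne rfl) (by omega)
  · refine ⟨_, ⟨i, 1, rfl⟩, ?_⟩
    rw [← pos_inner (wall m n hm) (by omega) (show 1 < len m (link i) by simp only [len]; omega)]
    simp
  · intro f hf
    rw [Walk.edges_cons, List.mem_cons] at hf
    rcases hf with rfl | hf
    · exact ⟨link i, 0, by simp [curves], h0, hseg⟩
    · obtain ⟨e, k, hc, hk, -, rfl⟩ := hedges f hf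
      exact ⟨e, k, hc, hk, rfl⟩

lemma exists_cycle_avoiding (hm : 2 < m) (F : Finset (Sym2 (WallVertex ⊕ WallEdge × ℕ)))
    (hF : F.card * 2 < n) :
    ∃ (w : WallVertex ⊕ WallEdge × ℕ) (c : (wall m n hm).subdivided.Walk w w), c.IsCycle ∧
      m ∣ c.length ∧ (∃ a ∈ linkVertices, a ∈ c.support) ∧ ∀ f ∈ c.edges, f ∉ F := by
  classical
  let hit : Sym2 (WallVertex ⊕ WallEdge × ℕ) → Finset ℕ := fun f =>
    if h : ∃ e k, k < len m e ∧ f = (wall m n hm).seg e k then curves h.choose else ∅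
  have hit_seg : ∀ {e k}, k < len m e → hit ((wall m n hm).seg e k) = curves e := by
    intro e k hk
    have h : ∃ e' k', k' < len m e' ∧ (wall m n hm).seg e k = (wall m n hm).seg e' k' :=
      ⟨e, k, hk, rfl⟩
    simp only [hit, dif_pos h]
    obtain ⟨k', hk', heq⟩ := h.choose_spec
    rw [← ((wall m n hm).seg_injective hk hk' heq).1]
  have hcard : (F.biUnion hit).card ≤ F.card * 2 := by
    refine Finset.card_biUnion_le_card_mul _ _ _ fun f _ => ?_
    simp only [hit]
    split_ifs
    · exact card_curves_le _
    · simp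
  obtain ⟨i, hi, hiF⟩ : ∃ i ∈ Finset.range n, i ∉ F.biUnion hit :=
    Finset.exists_mem_notMem_of_card_lt_card (by rw [Finset.card_range]; omega)
  obtain ⟨w, c, hc, hlen, hA, hedges⟩ := exists_cycle hm (Finset.mem_range.1 hi)
  refine ⟨w, c, hc, hlen, hA, fun f hf hfF => hiF ?_⟩
  obtain ⟨e, k, hie, hk, rfl⟩ := hedges f hf
  exact Finset.mem_biUnion.2 ⟨_, hfF, by rwa [hit_seg hk]⟩

lemma exists_link_of_mem_support {w : WallVertex ⊕ WallEdge × ℕ}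
    {c : (wall m n hm).subdivided.Walk w w} (hc : c.IsCycle)
    (hA : ∃ a ∈ linkVertices, a ∈ c.support) : ∃ k, link k ∈ trace c := by
  obtain ⟨_, ⟨k, t, rfl⟩, hmem⟩ := hA
  have h2 := hc.ncard_neighborSet_toSubgraph_eq_two hmem
  obtain ⟨z, hz⟩ := Set.nonempty_of_ncard_ne_zero (by rw [h2]; norm_num)
  rw [Subgraph.mem_neighborSet, Walk.adj_toSubgraph_iff_mem_edges] at hz
  obtain ⟨e, he, j, hj, heq⟩ := exists_seg_of_mem_cycle hc hz
  refine ⟨k, ?_⟩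
  have : e = link k := by
    simp only [seg, pos, Sym2.eq_iff] at heq
    grind
  rwa [← this]

lemma exists_common_edge {w₁ w₂ : WallVertex ⊕ WallEdge × ℕ}
    {c₁ : (wall m n hm).subdivided.Walk w₁ w₁} {c₂ : (wall m n hm).subdivided.Walk w₂ w₂}
    (hc₁ : c₁.IsCycle) (hc₂ : c₂.IsCycle) (hm₁ : m ∣ c₁.length) (hm₂ : m ∣ c₂.length)
    (hA₁ : ∃ a ∈ linkVertices, a ∈ c₁.support) (hA₂ : ∃ a ∈ linkVertices, a ∈ c₂.support) :
    ∃ f ∈ c₁.edges, f ∈ c₂.edges := by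
  obtain ⟨k, hk⟩ := exists_link_of_mem_support hc₁ hA₁
  obtain ⟨k', hk'⟩ := exists_link_of_mem_support hc₂ hA₂
  rw [length_eq_sum_trace hc₁] at hm₁
  rw [length_eq_sum_trace hc₂] at hm₂
  obtain ⟨e, h₁, h₂⟩ := Finset.not_disjoint_iff.1
    (not_disjoint (cycleLike_trace hc₁) (cycleLike_trace hc₂) hm₁ hm₂ hk hk')
  exact ⟨_, (mem_trace.1 h₁).2, (mem_trace.1 h₂).2⟩

end TriangularWall

namespace LengthMultigraph

open SimpleGraph

/-- The vertices of the subdivided graph that lie on an edge. -/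
def nonisolated {B E : Type} (N : LengthMultigraph B E) : Set (B ⊕ E × ℕ) :=
  ⋃ e ∈ N.edges, N.pos e '' Set.Iic (N.len e)

lemma finite_nonisolated {B E : Type} (N : LengthMultigraph B E) : N.nonisolated.Finite :=
  N.edges.finite_toSet.biUnion fun e _ => (Set.finite_Iic (N.len e)).image _

lemma mem_nonisolated {B E : Type} {N : LengthMultigraph B E} {a w : B ⊕ E × ℕ}
    {c : N.subdivided.Walk a a} (hc : c.IsCycle) (hw : w ∈ c.support) : w ∈ N.nonisolated := by
  have h2 := hc.ncard_neighborSet_toSubgraph_eq_two hw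
  obtain ⟨z, hz⟩ := Set.nonempty_of_ncard_ne_zero (by rw [h2]; norm_num)
  rw [Subgraph.mem_neighborSet, Walk.adj_toSubgraph_iff_mem_edges] at hz
  obtain ⟨e, he, k, hk, heq⟩ := exists_seg_of_mem_edges hz
  simp only [nonisolated, Set.mem_iUnion]
  rw [seg, Sym2.eq_iff] at heq
  rcases heq with ⟨rfl, -⟩ | ⟨-, rfl⟩
  · exact ⟨e, he, k, hk.le, rfl⟩
  · exact ⟨e, he, k + 1, hk, rfl⟩

end LengthMultigraph


/-- For every integer `m > 2`, `A`-cycles of length divisible by `m` do not have the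
edge-Erdős–Pósa property: for every `h` there is a graph with a vertex set `A` containing
no two edge-disjoint `A`-cycles of length divisible by `m`, in which no set of at most `h`
edges meets all such cycles. -/
theorem mod_m_A_cycles_no_edge_EP (m : ℕ) (hm : 2 < m) (h : ℕ) :
    ∃ (V : Type) (_ : Fintype V) (G : SimpleGraph V) (A : Set V),
      (¬ ∃ (v₁ v₂ : V) (c₁ : G.Walk v₁ v₁) (c₂ : G.Walk v₂ v₂),
        c₁.IsCycle ∧ c₂.IsCycle ∧ m ∣ c₁.length ∧ m ∣ c₂.length ∧
        (∃ a ∈ A, a ∈ c₁.support) ∧ (∃ a ∈ A, a ∈ c₂.support) ∧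
        ∀ e ∈ c₁.edges, e ∉ c₂.edges) ∧
      ∀ F : Finset (Sym2 V), F.card ≤ h →
        ∃ (v : V) (c : G.Walk v v), c.IsCycle ∧ m ∣ c.length ∧
          (∃ a ∈ A, a ∈ c.support) ∧ ∀ e ∈ c.edges, e ∉ F := by
  classical
  let N := TriangularWall.wall m (h * 2 + 1) hm
  let X := N.nonisolated
  let φ := SimpleGraph.Embedding.induce (G := N.subdivided) X
  have hφ : Function.Injective φ.toHom := φ.injective
  refine ⟨X, N.finite_nonisolated.fintype, N.subdivided.induce X,
    {a | a.1 ∈ TriangularWall.linkVertices}, ?_, ?_⟩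
  · rintro ⟨v₁, v₂, c₁, c₂, hc₁, hc₂, hm₁, hm₂, ⟨a₁, ha₁, hs₁⟩, ⟨a₂, ha₂, hs₂⟩, hd⟩
    obtain ⟨f, hf₁, hf₂⟩ := TriangularWall.exists_common_edge (hc₁.map hφ) (hc₂.map hφ)
      (by simpa using hm₁) (by simpa using hm₂)
      ⟨a₁.1, ha₁, by rw [SimpleGraph.Walk.support_map]; exact List.mem_map_of_mem hs₁⟩
      ⟨a₂.1, ha₂, by rw [SimpleGraph.Walk.support_map]; exact List.mem_map_of_mem hs₂⟩
    rw [SimpleGraph.Walk.edges_map, List.mem_map] at hf₁ hf₂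
    obtain ⟨f₁, hf₁, rfl⟩ := hf₁
    obtain ⟨f₂, hf₂, heq⟩ := hf₂
    rw [Sym2.map.injective hφ heq] at hf₂
    exact hd f₁ hf₁ hf₂
  · intro F hF
    obtain ⟨w, c, hc, hlen, ⟨a, haA, hac⟩, hav⟩ := TriangularWall.exists_cycle_avoiding hm
      (n := h * 2 + 1) (F.image (Sym2.map φ.toHom))
      (by have := Finset.card_image_le (s := F) (f := Sym2.map φ.toHom); omega)
    have hX : ∀ z ∈ c.support, z ∈ X := fun z hz => LengthMultigraph.mem_nonisolated hc hz
    have hmap : (c.induce X hX).map φ.toHom = c := SimpleGraph.Walk.map_induce c hX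
    refine ⟨_, c.induce X hX, ?_, ?_, ⟨⟨a, hX a hac⟩, haA, ?_⟩, ?_⟩
    · rw [← SimpleGraph.Walk.isCycle_map_iff_of_injective hφ, hmap]
      exact hc
    · rwa [← SimpleGraph.Walk.length_map φ.toHom, hmap]
    · simpa [SimpleGraph.Walk.support_induce] using hac
    · intro f hf hfF
      refine hav (Sym2.map φ.toHom f) ?_ (Finset.mem_image_of_mem _ hfF)
      have hedges := (congrArg SimpleGraph.Walk.edges hmap).symm.trans
        (SimpleGraph.Walk.edges_map φ.toHom (c.induce X hX))
      exact hedges ▸ List.mem_map_of_mem hf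
end
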